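/- arXiv:0908.1544 — 2 statements merged into one kernel-verified Lean document; each statement's English description precedes it below -/
import Mathlib

section
/- Let ε > 0, let ⟨X̃_{σ,τ} : (σ,τ) ∈ S⟩ be a solid tree (S a finite tree on ω × ω), let η ∈ ω^{<ω} with η ∉ proj[S] and η* ∈ proj[S] (where η* is η with its last digit removed), and let Y', Y ⊆ Ḣ × Ḧ satisfy Ẏ' ⊆ cl Ẏ. Then there exists a solid tree ⟨X̃'_{σ,τ} : (σ,τ) ∈ S'⟩ with S' ⊇ S and proj[S'] = proj[S] ∪ {η} such that: (1) for every τ ∈ S'_η, the diameter |X̃'_{η,τ}| < ε; (2) X̃'_{σ,τ} ⊆ X̃_{σ,τ} for every (σ,τ) ∈ S; (3) for every σ ∈ proj[S], the Hausdorff distance |Ẋ'_σ, Ẋ_σ| < ε; and (4) |Ẋ'_η, Ẏ'| < |Ẋ_{η*}, Ẏ| + ε. -/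
open MeasureTheory Metric Set Topology

noncomputable section

attribute [local instance] PiCountable.metricSpace

/-- The Hilbert cube `[0,1]^ℕ`, with a standard complete metric inducing the product
topology. -/
abbrev Hcube : Type := ℕ → unitInterval

/-- The unfolding space `(ω^ω)^ω × Ḣ × Ḧ` with the max metric; the projection `π` onto
`Ḣ × Ḧ` is `Prod.snd`. -/
abbrev UnfSp : Type := (ℕ → ℕ → ℕ) × (Hcube × Hcube)

/-- `G` is the graph of a continuous function. -/
def IsContGraph (G : Set (Hcube × Hcube)) : Prop :=
  ∃ (D : Set Hcube) (f : Hcube → Hcube), ContinuousOn f D ∧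
    G = {p : Hcube × Hcube | p.1 ∈ D ∧ p.2 = f p.1}

/-- `X` belongs to the σ-ideal `I` generated by graphs of continuous functions. -/
def CoveredByCtsGraphs (X : Set (Hcube × Hcube)) : Prop :=
  ∃ G : ℕ → Set (Hcube × Hcube), (∀ n, IsContGraph (G n)) ∧ X ⊆ ⋃ n, G n

/-- A nonempty analytic `X ⊆ A` is solid if every relatively open nonempty piece of it
is `I`-positive. -/
def Solid (A X : Set (Hcube × Hcube)) : Prop :=
  X.Nonempty ∧ AnalyticSet X ∧ X ⊆ A ∧
    ∀ U : Set (Hcube × Hcube), IsOpen U → U ∩ X = ∅ ∨ ¬ CoveredByCtsGraphs (U ∩ X)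

/-- `X̃` is a cylinder with base `X`. -/
def IsCylinder (Xt : Set UnfSp) (X : Set (Hcube × Hcube)) : Prop :=
  IsClosed Xt ∧ Prod.snd '' Xt = X ∧
    ∃ N : ℕ, ∀ x ∈ X, ∀ r s : ℕ → ℕ → ℕ,
      (∀ i < N, s i = r i) → (s, x) ∈ Xt → (r, x) ∈ Xt

/-- A tree on `ω × ω`: pairs of finite sequences of equal length, closed under taking
initial segments coordinatewise. -/
def IsTree2 (S : Set (List ℕ × List ℕ)) : Prop :=
  (∀ p ∈ S, p.1.length = p.2.length) ∧
    ∀ p ∈ S, ∀ n : ℕ, (p.1.take n, p.2.take n) ∈ S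

/-- `proj[S] = {σ : ∃ τ, (σ, τ) ∈ S}`. -/
def projTree (S : Set (List ℕ × List ℕ)) : Set (List ℕ) :=
  {σ | ∃ τ : List ℕ, (σ, τ) ∈ S}

/-- The projection `Ẋ` to `Ḣ` of the base of the cylinder `X̃`. -/
def dotB (Xt : Set UnfSp) : Set Hcube := (fun p : UnfSp => p.2.1) '' Xt

/-- The projection `Ẍ` to `Ḧ` of the base of the cylinder `X̃`. -/
def ddotB (Xt : Set UnfSp) : Set Hcube := (fun p : UnfSp => p.2.2) '' Xt

/-- `Ẋ_σ = ⋃ {Ẋ_{σ,τ} : τ ∈ S_σ}` for a family of cylinders indexed by `S`. -/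
def dotSec (Xt : List ℕ × List ℕ → Set UnfSp) (S : Set (List ℕ × List ℕ))
    (σ : List ℕ) : Set Hcube :=
  ⋃ τ ∈ {τ : List ℕ | (σ, τ) ∈ S}, dotB (Xt (σ, τ))

/-- A solid tree: a family of solid cylinders indexed by a finite tree `S` on `ω × ω`
such that `Ẋ_{σ,τ} ⊆ cl Ẋ_{σ*,τ*}` and the sets `Ẍ_{σ,τ}` are pairwise disjoint and
relatively open in their union. -/
def IsSolidTree (A : Set (Hcube × Hcube)) (S : Set (List ℕ × List ℕ))
    (Xt : List ℕ × List ℕ → Set UnfSp) : Prop :=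
  IsTree2 S ∧ S.Finite ∧
  (∀ p ∈ S, IsCylinder (Xt p) (Prod.snd '' Xt p) ∧ Solid A (Prod.snd '' Xt p)) ∧
  (∀ p ∈ S, dotB (Xt p) ⊆ closure (dotB (Xt (p.1.dropLast, p.2.dropLast)))) ∧
  (∀ p ∈ S, ∀ q ∈ S, p ≠ q → ddotB (Xt p) ∩ ddotB (Xt q) = ∅) ∧
  (∀ p ∈ S, ∃ U : Set Hcube, IsOpen U ∧
      ddotB (Xt p) = U ∩ ⋃ q ∈ S, ddotB (Xt q))


/-! ### The σ-ideal -/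

lemma isContGraph_empty : IsContGraph ∅ :=
  ⟨∅, id, continuousOn_empty _, by simp⟩

lemma cov_mono {X Y : Set (Hcube × Hcube)} (h : X ⊆ Y) (hY : CoveredByCtsGraphs Y) :
    CoveredByCtsGraphs X := by
  obtain ⟨G, hG, hs⟩ := hY
  exact ⟨G, hG, h.trans hs⟩

lemma cov_graph {X G : Set (Hcube × Hcube)} (hG : IsContGraph G) (h : X ⊆ G) :
    CoveredByCtsGraphs X :=
  ⟨fun _ => G, fun _ => hG, h.trans (subset_iUnion (fun _ : ℕ => G) 0)⟩

lemma cov_empty : CoveredByCtsGraphs ∅ := cov_graph isContGraph_empty (Subset.refl _)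

lemma cov_iUnion {X : ℕ → Set (Hcube × Hcube)} (h : ∀ n, CoveredByCtsGraphs (X n)) :
    CoveredByCtsGraphs (⋃ n, X n) := by
  choose G hG hs using h
  refine ⟨fun n => G n.unpair.1 n.unpair.2, fun n => hG _ _, ?_⟩
  refine iUnion_subset fun n x hx => ?_
  obtain ⟨m, hm⟩ := mem_iUnion.1 (hs n hx)
  refine mem_iUnion.2 ⟨Nat.pair n m, ?_⟩
  simpa using hm

lemma cov_biUnion {ι : Type*} {t : Set ι} (ht : t.Countable) {X : ι → Set (Hcube × Hcube)}
    (h : ∀ i ∈ t, CoveredByCtsGraphs (X i)) : CoveredByCtsGraphs (⋃ i ∈ t, X i) := by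
  rcases t.eq_empty_or_nonempty with rfl | hne
  · simpa using cov_empty
  · obtain ⟨f, rfl⟩ := ht.exists_eq_range hne
    rw [biUnion_range]
    exact cov_iUnion fun n => h _ ⟨n, rfl⟩

lemma cov_union {X Y : Set (Hcube × Hcube)} (hX : CoveredByCtsGraphs X)
    (hY : CoveredByCtsGraphs Y) : CoveredByCtsGraphs (X ∪ Y) := by
  have := cov_biUnion (t := (univ : Set Bool)) (Set.countable_univ)
    (X := fun b => if b then X else Y) (by rintro (_ | _) _ <;> simpa)
  refine cov_mono ?_ this
  rintro x (hx | hx)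
  · exact mem_biUnion (mem_univ true) (by simpa using hx)
  · exact mem_biUnion (mem_univ false) (by simpa using hx)

/-- The points all of whose neighbourhoods meet `X` in a positive set. -/
def posPts (X : Set (Hcube × Hcube)) : Set (Hcube × Hcube) :=
  {p | ∀ U : Set (Hcube × Hcube), IsOpen U → p ∈ U → ¬ CoveredByCtsGraphs (U ∩ X)}

lemma isClosed_posPts (X : Set (Hcube × Hcube)) : IsClosed (posPts X) := by
  rw [← isOpen_compl_iff, isOpen_iff_forall_mem_open]
  intro p hp
  simp only [posPts, mem_compl_iff, mem_ofPred_eq, not_forall, not_not] at hp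
  obtain ⟨U, hU, hpU, hc⟩ := hp
  exact ⟨U, fun q hq hq' => hq' U hU hq hc, hU, hpU⟩

lemma cov_diff_posPts (X : Set (Hcube × Hcube)) : CoveredByCtsGraphs (X \ posPts X) := by
  have H : ∀ p ∈ (posPts X)ᶜ, ∃ U : Set (Hcube × Hcube), IsOpen U ∧ p ∈ U ∧
      CoveredByCtsGraphs (U ∩ X) := by
    intro p hp
    simp only [posPts, mem_compl_iff, mem_ofPred_eq, not_forall, not_not] at hp
    obtain ⟨U, hU, hpU, hc⟩ := hp
    exact ⟨U, hU, hpU, hc⟩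
  choose! U hU hpU hc using H
  obtain ⟨t, hts, htc, hcov⟩ := TopologicalSpace.countable_cover_nhdsWithin
    (f := U) (s := (posPts X)ᶜ)
    (fun x hx => mem_nhdsWithin_of_mem_nhds ((hU x hx).mem_nhds (hpU x hx)))
  refine cov_mono ?_ (cov_biUnion htc (X := fun i => U i ∩ X) fun i hi => hc i (hts hi))
  rintro x ⟨hx, hx'⟩
  obtain ⟨i, hi, hxi⟩ := mem_iUnion₂.1 (hcov hx')
  exact mem_biUnion hi ⟨hxi, hx⟩

lemma pos_inter_posPts {X V : Set (Hcube × Hcube)} (h : ¬ CoveredByCtsGraphs (V ∩ X)) :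
    ¬ CoveredByCtsGraphs (V ∩ (X ∩ posPts X)) := by
  intro hc
  refine h (cov_mono ?_ (cov_union hc (cov_diff_posPts X)))
  rintro x ⟨hx, hx'⟩
  by_cases hp : x ∈ posPts X
  · exact Or.inl ⟨hx, hx', hp⟩
  · exact Or.inr ⟨hx', hp⟩

lemma nonempty_of_pos {X : Set (Hcube × Hcube)} (h : ¬ CoveredByCtsGraphs X) : X.Nonempty := by
  by_contra hne
  rw [not_nonempty_iff_eq_empty] at hne
  exact h (hne ▸ cov_empty)

/-- Positive sets have infinite second projection. -/
lemma infinite_of_pos {X : Set (Hcube × Hcube)} (h : ¬ CoveredByCtsGraphs X) :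
    (Prod.snd '' X).Infinite := by
  intro hf
  refine h (cov_mono ?_ (cov_biUnion hf.countable
    (X := fun y => {p : Hcube × Hcube | p.1 ∈ (univ : Set Hcube) ∧ p.2 = y}) ?_))
  · intro p hp
    exact mem_biUnion (mem_image_of_mem _ hp) ⟨mem_univ _, rfl⟩
  · intro y _
    exact cov_graph ⟨univ, fun _ => y, continuousOn_const, rfl⟩ (Subset.refl _)

/-! ### Cylinders -/

/-- Closed set depending on finitely many coordinates. -/
def Cyl (Z : Set UnfSp) : Prop :=
  IsClosed Z ∧ ∃ N : ℕ, ∀ x, ∀ r s : ℕ → ℕ → ℕ, (∀ i < N, s i = r i) → (s, x) ∈ Z → (r, x) ∈ Z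

lemma cyl_iff (Z : Set UnfSp) : IsCylinder Z (Prod.snd '' Z) ↔ Cyl Z := by
  constructor
  · rintro ⟨h1, -, N, h⟩
    exact ⟨h1, N, fun x r s hrs hs => h x ⟨_, hs, rfl⟩ r s hrs hs⟩
  · rintro ⟨h1, N, h⟩
    exact ⟨h1, rfl, N, fun x _ r s hrs hs => h x r s hrs hs⟩

lemma Cyl.inter {Z W : Set UnfSp} (hZ : Cyl Z) (hW : Cyl W) : Cyl (Z ∩ W) := by
  obtain ⟨h1, N, h⟩ := hZ
  obtain ⟨h1', N', h'⟩ := hW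
  exact ⟨h1.inter h1', max N N', fun x r s hrs hs =>
    ⟨h x r s (fun i hi => hrs i (lt_max_of_lt_left hi)) hs.1,
     h' x r s (fun i hi => hrs i (lt_max_of_lt_right hi)) hs.2⟩⟩

lemma cyl_preimage {F : Set (Hcube × Hcube)} (hF : IsClosed F) :
    Cyl ((Prod.snd : UnfSp → Hcube × Hcube) ⁻¹' F) :=
  ⟨hF.preimage continuous_snd, 0, fun _ _ _ _ hs => hs⟩

lemma Cyl.analytic {Z : Set UnfSp} (hZ : Cyl Z) : AnalyticSet (Prod.snd '' Z) :=
  (hZ.1.analyticSet).image_of_continuous continuous_snd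

/-- base -/
lemma Cyl.openCut {Z : Set UnfSp} (hZ : Cyl Z) {O : Set (Hcube × Hcube)} (hO : IsOpen O) :
    ∃ W : Set UnfSp, Cyl W ∧ W ⊆ Z ∧ Prod.snd '' W = Prod.snd '' Z ∩ O := by
  obtain ⟨h1, N, h⟩ := hZ
  obtain ⟨F, hFc, -, hFO, -⟩ := hO.exists_iUnion_isClosed
  have hcl : IsClosed {q : UnfSp | q.2 ∈ F (q.1 N 0)} := by
    have : {q : UnfSp | q.2 ∈ F (q.1 N 0)} =
        ⋂ n : ℕ, ({q : UnfSp | q.1 N 0 ∈ ({n} : Set ℕ)ᶜ} ∪ {q : UnfSp | q.2 ∈ F n}) := by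
      ext q
      simp only [mem_ofPred_eq, mem_iInter, mem_union, mem_compl_iff, mem_singleton_iff]
      constructor
      · intro hq n
        by_cases hn : q.1 N 0 = n
        · right; rwa [← hn]
        · left; exact hn
      · intro hq
        rcases hq (q.1 N 0) with h | h
        · exact absurd rfl h
        · exact h
    rw [this]
    refine isClosed_iInter fun n => IsClosed.union ?_ ?_
    · have : Continuous fun q : UnfSp => q.1 N 0 := by fun_prop
      exact (isClosed_discrete _).preimage this
    · exact (hFc n).preimage continuous_snd
  refine ⟨Z ∩ {q | q.2 ∈ F (q.1 N 0)}, ⟨h1.inter hcl, N + 1, ?_⟩, inter_subset_left, ?_⟩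
  · rintro x r s hrs ⟨hs, hs'⟩
    refine ⟨h x r s (fun i hi => hrs i (by omega)) hs, ?_⟩
    simp only [mem_ofPred_eq] at hs' ⊢
    rwa [← hrs N (by omega)]
  · ext x
    constructor
    · rintro ⟨q, ⟨hq, hq'⟩, rfl⟩
      exact ⟨⟨q, hq, rfl⟩, hFO ▸ mem_iUnion.2 ⟨_, hq'⟩⟩
    · rintro ⟨⟨⟨s, x⟩, hq, rfl⟩, hx⟩
      rw [← hFO] at hx
      obtain ⟨n, hn⟩ := mem_iUnion.1 hx
      refine ⟨(Function.update s N (fun _ => n), x), ⟨h _ _ s ?_ hq, ?_⟩, rfl⟩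
      · intro i hi
        rw [Function.update_of_ne hi.ne]
      · simpa using hn

/-- The solid part of a cylinder. -/
def coreCyl (Z : Set UnfSp) : Set UnfSp :=
  Z ∩ (Prod.snd : UnfSp → Hcube × Hcube) ⁻¹' posPts (Prod.snd '' Z)

lemma coreCyl_subset (Z : Set UnfSp) : coreCyl Z ⊆ Z := inter_subset_left

lemma coreCyl_base (Z : Set UnfSp) :
    Prod.snd '' coreCyl Z = Prod.snd '' Z ∩ posPts (Prod.snd '' Z) := by
  rw [coreCyl, image_inter_preimage]

lemma Cyl.core {Z : Set UnfSp} (hZ : Cyl Z) : Cyl (coreCyl Z) :=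
  hZ.inter (cyl_preimage (isClosed_posPts _))

/-- Hereditarily positive. -/
def HPos (X : Set (Hcube × Hcube)) : Prop :=
  ∀ U : Set (Hcube × Hcube), IsOpen U → U ∩ X = ∅ ∨ ¬ CoveredByCtsGraphs (U ∩ X)

lemma hpos_core (Z : Set UnfSp) : HPos (Prod.snd '' coreCyl Z) := by
  intro U hU
  rw [coreCyl_base]
  rcases (U ∩ (Prod.snd '' Z ∩ posPts (Prod.snd '' Z))).eq_empty_or_nonempty with h | h
  · exact Or.inl h
  · obtain ⟨p, hpU, -, hp⟩ := h
    exact Or.inr (pos_inter_posPts (hp U hU hpU))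

lemma HPos.inter_open {X O : Set (Hcube × Hcube)} (hX : HPos X) (hO : IsOpen O) :
    HPos (X ∩ O) := by
  intro U hU
  have := hX (U ∩ O) (hU.inter hO)
  rwa [inter_assoc, inter_comm O] at this

lemma dotB_eq (Z : Set UnfSp) : dotB Z = Prod.fst '' (Prod.snd '' Z) := by
  rw [dotB, image_image]

lemma ddotB_eq (Z : Set UnfSp) : ddotB Z = Prod.snd '' (Prod.snd '' Z) := by
  rw [ddotB, image_image]

lemma dotB_mono {Z W : Set UnfSp} (h : Z ⊆ W) : dotB Z ⊆ dotB W := image_mono h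
lemma ddotB_mono {Z W : Set UnfSp} (h : Z ⊆ W) : ddotB Z ⊆ ddotB W := image_mono h

/-- Small finitely determined closed neighbourhoods. -/
lemma exists_small_nhd (s : ℕ → ℕ → ℕ) {ρ : ℝ} (hρ : 0 < ρ) :
    ∃ K : Set (ℕ → ℕ → ℕ), K ∈ 𝓝 s ∧ K ⊆ closedBall s ρ ∧
      Cyl ((Prod.fst : UnfSp → (ℕ → ℕ → ℕ)) ⁻¹' K) := by
  have h1 : ball s ρ ∈ 𝓝 s := ball_mem_nhds s hρ
  obtain ⟨I, u, hu, hsub⟩ := (isOpen_pi_iff.1 (isOpen_ball (x := s) (ε := ρ))) s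
    (mem_ball_self hρ)
  have h2 : ∀ i, ∃ c : Set (ℕ → ℕ), i ∈ I → c ∈ 𝓝 (s i) ∧ IsClosed c ∧ c ⊆ u i := by
    intro i
    by_cases hi : i ∈ I
    · obtain ⟨c, h, h', h''⟩ := exists_mem_nhds_isClosed_subset ((hu i hi).1.mem_nhds (hu i hi).2)
      exact ⟨c, fun _ => ⟨h, h', h''⟩⟩
    · exact ⟨univ, fun h => absurd h hi⟩
  choose c hc using h2
  refine ⟨(I : Set ℕ).pi c, set_pi_mem_nhds I.finite_toSet fun i hi => (hc i hi).1, ?_, ?_, ?_⟩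
  · intro t ht
    exact ball_subset_closedBall (hsub fun i hi => (hc i hi).2.2 (ht i hi))
  · exact (isClosed_set_pi fun i hi => (hc i hi).2.1).preimage continuous_fst
  · refine ⟨I.sup id + 1, ?_⟩
    intro x r t hrt ht i hi
    have : i ≤ I.sup id := Finset.le_sup (f := id) hi
    have h3 := ht i hi
    simp only at h3 ⊢
    rw [← hrt i (by omega)]
    exact h3

/-! ### Discontinuity -/

lemma exists_discont {A X : Set (Hcube × Hcube)}
    (hgraph : ∀ x y y' : Hcube, (x, y) ∈ A → (x, y') ∈ A → y = y')
    (hXA : X ⊆ A) (hX : HPos X) {x₀ : Hcube} (hx₀ : x₀ ∈ Prod.fst '' X) {ρ : ℝ} (hρ : 0 < ρ) :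
    ∃ κ : ℝ, 0 < κ ∧ ∃ D : Set (Hcube × Hcube), D ⊆ X ∧ (∀ p ∈ D, p.1 ∈ ball x₀ ρ) ∧
      ¬ CoveredByCtsGraphs D ∧
      ∀ p ∈ D, p.1 ∈ closure (Prod.fst '' (X ∩ {q | q.2 ∉ closedBall p.2 κ})) := by
  classical
  by_contra hcon
  push Not at hcon
  let D : ℕ → Set (Hcube × Hcube) := fun k =>
    {p | p ∈ X ∧ p.1 ∈ ball x₀ ρ ∧
      p.1 ∈ closure (Prod.fst '' (X ∩ {q | q.2 ∉ closedBall p.2 (1 / ((k : ℝ) + 1))}))}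
  have hD : ∀ k, CoveredByCtsGraphs (D k) := by
    intro k
    by_contra hc
    obtain ⟨p, hp, hp'⟩ := hcon (1 / ((k : ℝ) + 1)) (by positivity) (D k) (fun p hp => hp.1)
      (fun p hp => hp.2.1) hc
    exact hp' hp.2.2
  -- the points of continuity
  let E : Set (Hcube × Hcube) := {p | p ∈ X ∧ ∀ k : ℕ,
      p.1 ∉ closure (Prod.fst '' (X ∩ {q | q.2 ∉ closedBall p.2 (1 / ((k : ℝ) + 1))}))}
  have hE : CoveredByCtsGraphs E := by
    let f : Hcube → Hcube := fun x => if h : ∃ y, (x, y) ∈ X then h.choose else x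
    have hf : ∀ p ∈ X, f p.1 = p.2 := by
      rintro ⟨x, y⟩ hp
      have h : ∃ y, (x, y) ∈ X := ⟨y, hp⟩
      have h1 : f x = h.choose := dif_pos h
      change f x = y
      rw [h1]
      exact hgraph x _ _ (hXA h.choose_spec) (hXA hp)
    refine cov_graph (G := {p : Hcube × Hcube | p.1 ∈ Prod.fst '' E ∧ p.2 = f p.1})
      ⟨Prod.fst '' E, f, ?_, rfl⟩ ?_
    · rintro x ⟨p, hp, rfl⟩
      change Filter.Tendsto f (𝓝[Prod.fst '' E] p.1) (𝓝 (f p.1))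
      rw [Metric.tendsto_nhds]
      intro e he
      obtain ⟨k, hk⟩ := exists_nat_one_div_lt he
      have h1 := hp.2 k
      rw [eventually_nhdsWithin_iff]
      filter_upwards [isClosed_closure.isOpen_compl.mem_nhds h1] with z hz hzE
      obtain ⟨q, hq, rfl⟩ := hzE
      rw [hf p hp.1, hf q hq.1]
      by_contra hlt
      refine hz (subset_closure ⟨q, ⟨hq.1, ?_⟩, rfl⟩)
      intro hmem
      exact hlt (lt_of_le_of_lt (mem_closedBall.1 hmem) hk)
    · intro p hp
      exact ⟨⟨p, hp, rfl⟩, (hf p hp.1).symm⟩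
  obtain ⟨p₀, hp₀, rfl⟩ := hx₀
  rcases hX (ball p₀.1 ρ ×ˢ univ) (isOpen_ball.prod isOpen_univ) with h | h
  · have : p₀ ∈ (ball p₀.1 ρ ×ˢ univ) ∩ X := ⟨⟨mem_ball_self hρ, mem_univ _⟩, hp₀⟩
    rw [h] at this
    exact this
  · refine h (cov_mono ?_ (cov_union (cov_iUnion hD) hE))
    rintro p ⟨⟨hpb, -⟩, hpX⟩
    by_cases hp : ∀ k : ℕ,
      p.1 ∉ closure (Prod.fst '' (X ∩ {q | q.2 ∉ closedBall p.2 (1 / ((k : ℝ) + 1))}))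
    · exact Or.inr ⟨hpX, hp⟩
    · push Not at hp
      obtain ⟨k, hk⟩ := hp
      exact Or.inl (mem_iUnion.2 ⟨k, hpX, hpb, hk⟩)

lemma exists_sep (F : Finset Hcube) : ∃ r : ℝ, 0 < r ∧
    ∀ y ∈ F, ∀ y' ∈ F, y ≠ y' → r ≤ dist y y' := by
  classical
  have H : ∀ G : Finset (Hcube × Hcube), ∃ r : ℝ, 0 < r ∧
      ∀ p ∈ G, p.1 ≠ p.2 → r ≤ dist p.1 p.2 := by
    intro G
    induction G using Finset.induction_on with
    | empty => exact ⟨1, one_pos, by simp⟩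
    | insert a s ha ih =>
      obtain ⟨r, hr, h⟩ := ih
      by_cases hne : a.1 = a.2
      · refine ⟨r, hr, fun p hp hpn => ?_⟩
        rcases Finset.mem_insert.1 hp with rfl | hp
        · exact absurd hne hpn
        · exact h p hp hpn
      · refine ⟨min r (dist a.1 a.2), lt_min hr (dist_pos.2 hne), fun p hp hpn => ?_⟩
        rcases Finset.mem_insert.1 hp with rfl | hp
        · exact min_le_right _ _
        · exact (min_le_left _ _).trans (h p hp hpn)
  obtain ⟨r, hr, h⟩ := H (F ×ˢ F)
  exact ⟨r, hr, fun y hy y' hy' hne => h (y, y') (Finset.mk_mem_product hy hy') hne⟩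

lemma exists_candidates {A X : Set (Hcube × Hcube)}
    (hgraph : ∀ x y y' : Hcube, (x, y) ∈ A → (x, y') ∈ A → y = y')
    (hXA : X ⊆ A) (hX : HPos X) {x₀ : Hcube} (hx₀ : x₀ ∈ Prod.fst '' X) {ρ : ℝ} (hρ : 0 < ρ)
    (M : ℕ) :
    ∃ F : Finset Hcube, F.card = M ∧ ∃ r : ℝ, 0 < r ∧ r ≤ ρ ∧
      (∀ y ∈ F, ∀ y' ∈ F, y ≠ y' → Disjoint (closedBall y r) (closedBall y' r)) ∧
      ∀ y ∈ F, ¬ CoveredByCtsGraphs (X ∩ {p | p.1 ∈ closedBall x₀ ρ ∧ p.2 ∈ closedBall y (r / 2) ∧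
        p.1 ∈ closure (Prod.fst '' (X ∩ {q | q.2 ∉ closedBall y r}))}) := by
  obtain ⟨κ, hκ, D, hDX, hDb, hDp, hD⟩ := exists_discont hgraph hXA hX hx₀ hρ
  have h1 : ¬ CoveredByCtsGraphs (D ∩ posPts D) := by
    have := pos_inter_posPts (X := D) (V := univ) (by rwa [univ_inter])
    rwa [univ_inter] at this
  obtain ⟨F, hFs, hFc⟩ := (infinite_of_pos h1).exists_subset_card_eq M
  obtain ⟨d, hd, hsep⟩ := exists_sep F
  refine ⟨F, hFc, min (min ρ (κ / 2)) (d / 3), by positivity,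
    (min_le_left _ _).trans (min_le_left _ _), ?_, ?_⟩
  · intro y hy y' hy' hne
    apply closedBall_disjoint_closedBall
    have := hsep y hy y' hy' hne
    have := min_le_right (min ρ (κ / 2)) (d / 3)
    linarith
  · intro y hy
    set r := min (min ρ (κ / 2)) (d / 3) with hr
    have hr0 : 0 < r := by positivity
    have hrκ : r ≤ κ / 2 := (min_le_left _ _).trans (min_le_right _ _)
    obtain ⟨p, ⟨hpD, hpp⟩, rfl⟩ := hFs hy
    have h2 := hpp (univ ×ˢ ball p.2 (r / 2)) (isOpen_univ.prod isOpen_ball)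
      ⟨mem_univ _, mem_ball_self (by positivity)⟩
    intro hc
    refine h2 (cov_mono ?_ hc)
    rintro q ⟨⟨-, hq⟩, hqD⟩
    refine ⟨hDX hqD, ball_subset_closedBall (hDb q hqD), ball_subset_closedBall hq, ?_⟩
    refine closure_mono (image_mono (inter_subset_inter_right _ ?_)) (hD q hqD)
    intro z hz hz'
    apply hz
    have e1 : dist z.2 p.2 ≤ r := hz'
    have e2 : dist q.2 p.2 < r / 2 := hq
    have e3 := dist_triangle_right z.2 q.2 p.2
    change dist z.2 q.2 ≤ κ
    linarith

/-! ### Cutting a tree -/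

/-- Replace the node at `ξ` by `W` and propagate to the nodes above. -/
def cutTree (Xt : List ℕ × List ℕ → Set UnfSp) (ξ : List ℕ × List ℕ) (W : Set UnfSp)
    (p : List ℕ × List ℕ) : Set UnfSp :=
  open Classical in
  if p = ξ then W
  else if _h : p.1.length ≤ ξ.1.length then Xt p
  else coreCyl (Xt p ∩ (Prod.snd : UnfSp → Hcube × Hcube) ⁻¹' (Prod.fst ⁻¹'
    closure (dotB (cutTree Xt ξ W (p.1.dropLast, p.2.dropLast)))))
termination_by p.1.length
decreasing_by
  simp only [List.length_dropLast]
  omega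

section cut
variable {Xt : List ℕ × List ℕ → Set UnfSp} {ξ : List ℕ × List ℕ} {W : Set UnfSp}
  {p : List ℕ × List ℕ}

lemma cutTree_self : cutTree Xt ξ W ξ = W := by
  rw [cutTree, if_pos rfl]

lemma cutTree_low (hp : p ≠ ξ) (h : p.1.length ≤ ξ.1.length) : cutTree Xt ξ W p = Xt p := by
  rw [cutTree, if_neg hp, dif_pos h]

lemma cutTree_high (h : ¬ p.1.length ≤ ξ.1.length) : cutTree Xt ξ W p =
    coreCyl (Xt p ∩ (Prod.snd : UnfSp → Hcube × Hcube) ⁻¹' (Prod.fst ⁻¹'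
    closure (dotB (cutTree Xt ξ W (p.1.dropLast, p.2.dropLast))))) := by
  rw [cutTree, if_neg (by rintro rfl; exact h le_rfl), dif_neg h]

lemma cutTree_subset (hW : W ⊆ Xt ξ) : cutTree Xt ξ W p ⊆ Xt p := by
  by_cases hp : p = ξ
  · subst hp; rwa [cutTree_self]
  by_cases h : p.1.length ≤ ξ.1.length
  · rw [cutTree_low hp h]
  · rw [cutTree_high h]
    exact (coreCyl_subset _).trans inter_subset_left

lemma cutTree_cyl (hW : Cyl W) (hp : Cyl (Xt p)) : Cyl (cutTree Xt ξ W p) := by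
  by_cases hp : p = ξ
  · subst hp; rwa [cutTree_self]
  by_cases h : p.1.length ≤ ξ.1.length
  · rwa [cutTree_low hp h]
  · rw [cutTree_high h]
    exact (Cyl.inter ‹_› (cyl_preimage (isClosed_closure.preimage continuous_fst))).core

lemma cutTree_hpos (hW : HPos (Prod.snd '' W)) (hp : HPos (Prod.snd '' Xt p)) :
    HPos (Prod.snd '' cutTree Xt ξ W p) := by
  by_cases hp : p = ξ
  · subst hp; rwa [cutTree_self]
  by_cases h : p.1.length ≤ ξ.1.length
  · rwa [cutTree_low hp h]
  · rw [cutTree_high h]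
    exact hpos_core _

lemma cutTree_closure (hW : W ⊆ Xt ξ) (hlen : p.1.length = p.2.length)
    (hp : dotB (Xt p) ⊆ closure (dotB (Xt (p.1.dropLast, p.2.dropLast)))) :
    dotB (cutTree Xt ξ W p) ⊆ closure (dotB (cutTree Xt ξ W (p.1.dropLast, p.2.dropLast))) := by
  by_cases h : p.1.length ≤ ξ.1.length
  · by_cases h0 : p.1.length = 0
    · have h1 : p.1 = [] := List.length_eq_zero_iff.1 h0
      have h2 : p.2 = [] := List.length_eq_zero_iff.1 (hlen ▸ h0)
      have : (p.1.dropLast, p.2.dropLast) = p := by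
        ext1 <;> simp [h1, h2]
      rw [this]
      exact subset_closure
    · have hl : (p.1.dropLast).length < p.1.length := by
        rw [List.length_dropLast]; omega
      rw [cutTree_low (p := (p.1.dropLast, p.2.dropLast)) (by rintro rfl; exact absurd h (by simpa using hl))
        (by simp only; omega)]
      exact (dotB_mono (cutTree_subset hW)).trans hp
  · rw [cutTree_high h]
    refine (dotB_mono (coreCyl_subset _)).trans ?_
    rintro x ⟨q, hq, rfl⟩
    exact hq.2

lemma cutTree_two {S : Set (List ℕ × List ℕ)} {W' : Set UnfSp} (hS : IsTree2 S)
    (hpos : ∀ p ∈ S, HPos (Prod.snd '' Xt p))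
    (hcl : ∀ p ∈ S, dotB (Xt p) ⊆ closure (dotB (Xt (p.1.dropLast, p.2.dropLast))))
    (hWW : dotB (Xt ξ) ⊆ closure (dotB W) ∪ closure (dotB W')) :
    ∀ (n : ℕ) (p : List ℕ × List ℕ), p.1.length = n → p ∈ S →
      dotB (Xt p) ⊆ closure (dotB (cutTree Xt ξ W p)) ∪ closure (dotB (cutTree Xt ξ W' p)) := by
  intro n
  induction n with
  | zero =>
    intro p hn hp
    by_cases hpx : p = ξ
    · subst hpx; rwa [cutTree_self, cutTree_self]
    · rw [cutTree_low hpx (by omega), cutTree_low hpx (by omega), union_self]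
      exact subset_closure
  | succ n ih =>
    intro p hn hp
    by_cases hpx : p = ξ
    · subst hpx; rwa [cutTree_self, cutTree_self]
    by_cases h : p.1.length ≤ ξ.1.length
    · rw [cutTree_low hpx h, cutTree_low hpx h, union_self]
      exact subset_closure
    have hpar : (p.1.dropLast, p.2.dropLast) ∈ S := by
      have := hS.2 p hp n
      rw [List.dropLast_eq_take, List.dropLast_eq_take, ← hS.1 p hp, hn]
      exact this
    have ih' := ih (p.1.dropLast, p.2.dropLast) (by simp [hn]) hpar
    have hcov : dotB (Xt p) ⊆ closure (dotB (cutTree Xt ξ W (p.1.dropLast, p.2.dropLast))) ∪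
        closure (dotB (cutTree Xt ξ W' (p.1.dropLast, p.2.dropLast))) :=
      (hcl p hp).trans (closure_minimal ih' (isClosed_closure.union isClosed_closure))
    intro x hx
    by_contra hxn
    rw [mem_union, not_or, cutTree_high h, cutTree_high h] at hxn
    set C := closure (dotB (cutTree Xt ξ W (p.1.dropLast, p.2.dropLast)))
    set C' := closure (dotB (cutTree Xt ξ W' (p.1.dropLast, p.2.dropLast)))
    have key : ∀ C : Set Hcube, ∀ U : Set Hcube, Disjoint U (dotB (coreCyl (Xt p ∩
        (Prod.snd : UnfSp → Hcube × Hcube) ⁻¹' (Prod.fst ⁻¹' C)))) →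
        CoveredByCtsGraphs ((U ×ˢ univ) ∩ (Prod.snd '' Xt p ∩ Prod.fst ⁻¹' C)) := by
      intro C U hU
      by_contra hc
      rw [← image_inter_preimage] at hc
      have := nonempty_of_pos (pos_inter_posPts hc)
      rw [← coreCyl_base] at this
      obtain ⟨q, ⟨hqU, -⟩, hq⟩ := this
      refine disjoint_left.1 hU hqU ?_
      rw [dotB_eq]
      exact mem_image_of_mem _ hq
    set T := dotB (coreCyl (Xt p ∩ (Prod.snd : UnfSp → Hcube × Hcube) ⁻¹' (Prod.fst ⁻¹' C)))
    set T' := dotB (coreCyl (Xt p ∩ (Prod.snd : UnfSp → Hcube × Hcube) ⁻¹' (Prod.fst ⁻¹' C')))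
    set U : Set Hcube := (closure T)ᶜ ∩ (closure T')ᶜ
    have hU : IsOpen U := isClosed_closure.isOpen_compl.inter isClosed_closure.isOpen_compl
    have k1 := key C U (disjoint_left.2 fun z hz hz' => hz.1 (subset_closure hz'))
    have k2 := key C' U (disjoint_left.2 fun z hz hz' => hz.2 (subset_closure hz'))
    rw [dotB_eq] at hx
    obtain ⟨q, hq, rfl⟩ := hx
    rcases hpos p hp (U ×ˢ univ) (hU.prod isOpen_univ) with h3 | h3
    · have : q ∈ (U ×ˢ univ) ∩ Prod.snd '' Xt p := ⟨⟨hxn, mem_univ _⟩, hq⟩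
      rw [h3] at this
      exact this
    · refine h3 (cov_mono ?_ (cov_union k1 k2))
      rintro z ⟨hzU, hz⟩
      have : z.1 ∈ C ∪ C' := hcov (by rw [dotB_eq]; exact mem_image_of_mem _ hz)
      rcases this with hzC | hzC
      · exact Or.inl ⟨hzU, hz, hzC⟩
      · exact Or.inr ⟨hzU, hz, hzC⟩

end cut

/-! ### One step -/

lemma exists_small_solid {Z : Set UnfSp} (hZ : Cyl Z) (hp : ¬ CoveredByCtsGraphs (Prod.snd '' Z))
    {ρ : ℝ} (hρ : 0 < ρ) :
    ∃ C : Set UnfSp, C ⊆ Z ∧ Cyl C ∧ HPos (Prod.snd '' C) ∧ C.Nonempty ∧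
      ∃ s, ∀ q ∈ C, q.1 ∈ closedBall s ρ := by
  choose K hK hKb hKc using fun s => exists_small_nhd s hρ
  obtain ⟨t, htc, ht⟩ := TopologicalSpace.countable_cover_nhds hK
  have : ∃ s, ¬ CoveredByCtsGraphs (Prod.snd '' (Z ∩ (Prod.fst : UnfSp → (ℕ → ℕ → ℕ)) ⁻¹' K s)) := by
    by_contra hcon
    push Not at hcon
    refine hp (cov_mono ?_ (cov_biUnion htc fun s _ => hcon s))
    rintro x ⟨q, hq, rfl⟩
    obtain ⟨s, hs, hqs⟩ := mem_iUnion₂.1 (ht ▸ mem_univ q.1)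
    exact mem_biUnion hs ⟨q, ⟨hq, hqs⟩, rfl⟩
  obtain ⟨s, hs⟩ := this
  refine ⟨_, (coreCyl_subset _).trans inter_subset_left, (hZ.inter (hKc s)).core, hpos_core _,
    ?_, s, fun q hq => hKb s hq.1.2⟩
  have := nonempty_of_pos (pos_inter_posPts (V := univ) (by rwa [univ_inter]))
  rw [univ_inter, ← coreCyl_base] at this
  exact this.of_image

lemma exists_net (T : Set Hcube) {δ : ℝ} (hδ : 0 < δ) :
    ∃ N ⊆ T, N.Finite ∧ ∀ x ∈ T, ∃ z ∈ N, dist x z < δ := by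
  have h : TotallyBounded T :=
    TotallyBounded.subset (subset_univ T) isCompact_univ.totallyBounded
  obtain ⟨N, hN, hf, hc⟩ := Metric.finite_approx_of_totallyBounded h δ hδ
  refine ⟨N, hN, hf, fun x hx => ?_⟩
  obtain ⟨z, hz, hxz⟩ := mem_iUnion₂.1 (hc hx)
  exact ⟨z, hz, hxz⟩

lemma one_step {A : Set (Hcube × Hcube)}
    (hgraph : ∀ x y y' : Hcube, (x, y) ∈ A → (x, y') ∈ A → y = y')
    {S : Set (List ℕ × List ℕ)} {Xt : List ℕ × List ℕ → Set UnfSp}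
    (hST : IsSolidTree A S Xt) {ξ : List ℕ × List ℕ} (hξ : ξ ∈ S) (a : ℕ)
    {x₀ : Hcube} (hx₀ : x₀ ∈ dotB (Xt ξ)) {δ : ℝ} (hδ : 0 < δ) :
    ∃ (τ : List ℕ) (Xt' : List ℕ × List ℕ → Set UnfSp),
      (ξ.1 ++ [a], τ) ∉ S ∧ IsSolidTree A (insert (ξ.1 ++ [a], τ) S) Xt' ∧
      (∀ p ∈ S, Xt' p ⊆ Xt p) ∧
      (∀ p ∈ S, ∀ x ∈ dotB (Xt p), ∃ x' ∈ dotB (Xt' p), dist x x' < δ) ∧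
      (∀ q ∈ Xt' (ξ.1 ++ [a], τ), ∀ q' ∈ Xt' (ξ.1 ++ [a], τ), dist q q' ≤ δ) ∧
      (∀ x ∈ dotB (Xt' (ξ.1 ++ [a], τ)), dist x x₀ ≤ δ) := by
  classical
  obtain ⟨hT, hfin, hcs, hcl, hdis, hop⟩ := hST
  have hcyl : ∀ p ∈ S, Cyl (Xt p) := fun p hp => (cyl_iff _).1 (hcs p hp).1
  have hpos : ∀ p ∈ S, HPos (Prod.snd '' Xt p) := fun p hp => (hcs p hp).2.2.2.2
  have hsA : ∀ p ∈ S, Prod.snd '' Xt p ⊆ A := fun p hp => (hcs p hp).2.2.2.1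
  have hne : ∀ p ∈ S, (Xt p).Nonempty := fun p hp => (hcs p hp).2.1.of_image
  choose! U hU hUeq using hop
  have hUsub : ∀ p ∈ S, ddotB (Xt p) ⊆ U p := fun p hp => by
    rw [hUeq p hp]; exact inter_subset_left
  have hUdis : ∀ p ∈ S, ∀ q ∈ S, p ≠ q → ∀ y ∈ U p, y ∉ ddotB (Xt q) := by
    intro p hp q hq hpq y hy hy'
    have h1 : y ∈ ddotB (Xt p) := by
      rw [hUeq p hp]; exact ⟨hy, mem_biUnion hq hy'⟩
    have h2 : y ∈ ddotB (Xt p) ∩ ddotB (Xt q) := ⟨h1, hy'⟩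
    rw [hdis p hp q hq hpq] at h2
    exact h2
  -- fresh index
  obtain ⟨k, hk⟩ : ∃ k : ℕ, (ξ.1 ++ [a], ξ.2 ++ [k]) ∉ S := by
    by_contra hcon
    push Not at hcon
    refine Set.infinite_of_injective_forall_mem (f := fun k : ℕ => (ξ.1 ++ [a], ξ.2 ++ [k])) ?_
      hcon hfin
    intro k k' h
    simpa using h
  -- nets
  choose N hNs hNf hN using fun p => exists_net (dotB (Xt p)) (half_pos hδ)
  have hnetfin : (⋃ p ∈ S, (fun x => (p, x)) '' N p).Finite :=
    hfin.biUnion fun p _ => (hNf p).image _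
  set net := hnetfin.toFinset with hnet
  have hx₀' : x₀ ∈ Prod.fst '' (Prod.snd '' Xt ξ) := by rwa [← dotB_eq]
  obtain ⟨F, hFc, r, hr, hrδ, hFd, hFp⟩ := exists_candidates hgraph (hsA ξ hξ) (hpos ξ hξ) hx₀'
    (half_pos hδ) (net.card + 1)
  -- open cuts
  have hcut : ∀ y : Hcube, ∃ W : Set UnfSp, Cyl W ∧ W ⊆ Xt ξ ∧
      Prod.snd '' W = Prod.snd '' Xt ξ ∩ {q | q.2 ∉ closedBall y r} := fun y =>
    (hcyl ξ hξ).openCut ((isClosed_closedBall.preimage continuous_snd).isOpen_compl)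
  choose W hWc hWs hWb using hcut
  have htwo : ∀ y ∈ F, ∀ y' ∈ F, y ≠ y' → ∀ p ∈ S, dotB (Xt p) ⊆
      closure (dotB (cutTree Xt ξ (W y) p)) ∪ closure (dotB (cutTree Xt ξ (W y') p)) := by
    intro y hy y' hy' hyy p hp
    refine cutTree_two hT hpos hcl ?_ _ p rfl hp
    rw [dotB_eq, dotB_eq, dotB_eq, hWb, hWb]
    rintro x ⟨q, hq, rfl⟩
    by_cases h : q.2 ∈ closedBall y r
    · refine Or.inr (subset_closure ⟨q, ⟨hq, ?_⟩, rfl⟩)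
      exact disjoint_left.1 (hFd y hy y' hy' hyy) h
    · exact Or.inl (subset_closure ⟨q, ⟨hq, h⟩, rfl⟩)
  -- the good candidate
  obtain ⟨y, hyF, hy⟩ : ∃ y ∈ F, ∀ t ∈ net, t.2 ∈ closure (dotB (cutTree Xt ξ (W y) t.1)) := by
    by_contra hcon
    push Not at hcon
    choose! b hb hb' using hcon
    obtain ⟨y, hy, y', hy', hyy, hbb⟩ :=
      Finset.exists_ne_map_eq_of_card_lt_of_maps_to (s := F) (t := net) (f := b)
        (by omega) (fun y hy => hb y hy)
    have h1 : b y ∈ ⋃ p ∈ S, (fun x => (p, x)) '' N p := hnetfin.mem_toFinset.1 (hb y hy)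
    obtain ⟨p, hp, x, hx, hxb⟩ := mem_iUnion₂.1 h1
    have h2 := hb' y hy
    have h3 := hb' y' hy'
    rw [← hbb] at h3
    simp only [← hxb] at h2 h3
    rcases htwo y hy y' hy' hyy p hp (hNs p hx) with h | h
    · exact h2 h
    · exact h3 h
  have hclose : ∀ p ∈ S, ∀ x ∈ dotB (Xt p), ∃ x' ∈ dotB (cutTree Xt ξ (W y) p), dist x x' < δ := by
    intro p hp x hx
    obtain ⟨z, hz, hxz⟩ := hN p x hx
    have := hy (p, z) (hnetfin.mem_toFinset.2 (mem_biUnion hp ⟨z, hz, rfl⟩))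
    obtain ⟨x', hx', hzx⟩ := Metric.mem_closure_iff.1 this (δ / 2) (half_pos hδ)
    exact ⟨x', hx', by linarith [dist_triangle x z x']⟩
  -- the new node
  obtain ⟨C, hCs, hCc, hCp, hCn, s, hCb⟩ := exists_small_solid
    (Z := Xt ξ ∩ (Prod.snd : UnfSp → Hcube × Hcube) ⁻¹' {p | p.1 ∈ closedBall x₀ (δ / 2) ∧
      p.2 ∈ closedBall y (r / 2) ∧
        p.1 ∈ closure (Prod.fst '' (Prod.snd '' Xt ξ ∩ {q | q.2 ∉ closedBall y r}))})
    ((hcyl ξ hξ).inter (cyl_preimage ((isClosed_closedBall.preimage continuous_fst).inter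
      ((isClosed_closedBall.preimage continuous_snd).inter
        (isClosed_closure.preimage continuous_fst)))))
    (by rw [image_inter_preimage]; exact hFp y hyF) (half_pos hδ)
  set ν : List ℕ × List ℕ := (ξ.1 ++ [a], ξ.2 ++ [k]) with hν
  have hνS : ∀ p ∈ S, p ≠ ν := fun p hp h => hk (h ▸ hp)
  have hpar : ∀ p ∈ S, (p.1.dropLast, p.2.dropLast) ∈ S := by
    intro p hp
    have := hT.2 p hp (p.1.length - 1)
    rw [List.dropLast_eq_take, List.dropLast_eq_take, ← hT.1 p hp]
    exact this
  let Xt' : List ℕ × List ℕ → Set UnfSp := fun q => if q = ν then C else cutTree Xt ξ (W y) q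
  have hX'ν : Xt' ν = C := if_pos rfl
  have hX'S : ∀ p ∈ S, Xt' p = cutTree Xt ξ (W y) p := fun p hp => if_neg (hνS p hp)
  have hX'sub : ∀ p ∈ S, Xt' p ⊆ Xt p := fun p hp => by
    rw [hX'S p hp]; exact cutTree_subset (hWs y)
  have hCξ : C ⊆ Xt ξ := hCs.trans inter_subset_left
  have hWpos : HPos (Prod.snd '' W y) := by
    rw [hWb]
    exact (hpos ξ hξ).inter_open ((isClosed_closedBall.preimage continuous_snd).isOpen_compl)
  -- separating open sets
  have hsep : ∃ V : List ℕ × List ℕ → Set Hcube, (∀ p ∈ insert ν S, IsOpen (V p)) ∧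
      (∀ p ∈ insert ν S, ddotB (Xt' p) ⊆ V p) ∧
      ∀ p ∈ insert ν S, ∀ q ∈ insert ν S, p ≠ q → ∀ y ∈ V p, y ∉ ddotB (Xt' q) := by
    have hCball : ∀ z ∈ ddotB C, z ∈ ball y r := by
      rintro z ⟨q, hq, rfl⟩
      have h3 : dist q.2.2 y ≤ r / 2 := (hCs hq).2.2.1
      change dist q.2.2 y < r
      linarith
    have hWball : ∀ z ∈ ddotB (W y), z ∉ closedBall y r := by
      intro z hz
      rw [ddotB_eq, hWb] at hz
      obtain ⟨q, hq, rfl⟩ := hz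
      exact hq.2
    refine ⟨fun p => if p = ν then U ξ ∩ ball y r else if p = ξ then U ξ ∩ (closedBall y r)ᶜ
      else U p, ?_, ?_, ?_⟩
    · rintro p (rfl | hp)
      · beta_reduce
        rw [if_pos rfl]; exact (hU ξ hξ).inter isOpen_ball
      · beta_reduce
        rw [if_neg (hνS p hp)]
        split_ifs with h
        · exact (hU ξ hξ).inter isClosed_closedBall.isOpen_compl
        · exact hU p hp
    · rintro p (rfl | hp)
      · beta_reduce
        rw [if_pos rfl, hX'ν]
        exact fun z hz => ⟨hUsub ξ hξ (ddotB_mono hCξ hz), hCball z hz⟩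
      · beta_reduce
        rw [if_neg (hνS p hp)]
        split_ifs with h
        · subst h
          intro z hz
          refine ⟨hUsub p hp (ddotB_mono (hX'sub p hp) hz), ?_⟩
          rw [hX'S p hp, cutTree_self] at hz
          exact hWball z hz
        · exact (ddotB_mono (hX'sub p hp)).trans (hUsub p hp)
    · rintro p (rfl | hp) q (rfl | hq) hpq z hz hz'
      · exact hpq rfl
      · beta_reduce at hz
        rw [if_pos rfl] at hz
        by_cases h : q = ξ
        · subst h
          rw [hX'S q hq, cutTree_self] at hz'
          exact hWball z hz' (ball_subset_closedBall hz.2)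
        · exact hUdis ξ hξ q hq (Ne.symm h) z hz.1 (ddotB_mono (hX'sub q hq) hz')
      · beta_reduce at hz
        rw [if_neg (hνS p hp)] at hz
        rw [hX'ν] at hz'
        split_ifs at hz with h
        · exact hz.2 (ball_subset_closedBall (hCball z hz'))
        · exact hUdis p hp ξ hξ h z hz (ddotB_mono hCξ hz')
      · beta_reduce at hz
        rw [if_neg (hνS p hp)] at hz
        have hz'' := ddotB_mono (hX'sub q hq) hz'
        split_ifs at hz with h
        · subst h
          exact hUdis p hp q hq hpq z hz.1 hz''
        · exact hUdis p hp q hq hpq z hz hz''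
  obtain ⟨V, hVo, hVs, hVd⟩ := hsep
  refine ⟨ξ.2 ++ [k], Xt', hk, ⟨⟨?_, ?_⟩, hfin.insert _, ?_, ?_, ?_, ?_⟩, hX'sub, ?_, ?_, ?_⟩
  · rintro p (rfl | hp)
    · simp [hT.1 ξ hξ]
    · exact hT.1 p hp
  · rintro p (rfl | hp) n
    · have hl := hT.1 ξ hξ
      by_cases hn : n ≤ ξ.1.length
      · right
        rw [List.take_append_of_le_length hn, List.take_append_of_le_length (hl ▸ hn)]
        exact hT.2 ξ hξ n
      · left
        rw [List.take_of_length_le (by simp; omega), List.take_of_length_le (by simp; omega)]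
    · exact Or.inr (hT.2 p hp n)
  · rintro p (rfl | hp)
    · change IsCylinder (Xt' ν) _ ∧ Solid A (Prod.snd '' Xt' ν)
      rw [hX'ν]
      exact ⟨(cyl_iff _).2 hCc, hCn.image _, hCc.analytic, (image_mono hCξ).trans (hsA ξ hξ), hCp⟩
    · have hc : Cyl (Xt' p) := by
        rw [hX'S p hp]; exact cutTree_cyl (hWc y) (hcyl p hp)
      refine ⟨(cyl_iff _).2 hc, Nonempty.image _ ?_, hc.analytic,
        (image_mono (hX'sub p hp)).trans (hsA p hp), ?_⟩
      · rw [hX'S p hp]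
        obtain ⟨q, hq⟩ := hne p hp
        obtain ⟨x', hx', -⟩ := hclose p hp _ ⟨q, hq, rfl⟩
        exact Set.Nonempty.of_image ⟨x', hx'⟩
      · rw [hX'S p hp]
        exact cutTree_hpos hWpos (hpos p hp)
  · rintro p (rfl | hp)
    · have h1 : ((ξ.1 ++ [a]).dropLast, (ξ.2 ++ [k]).dropLast) = ξ := by simp
      change dotB (Xt' ν) ⊆ closure (dotB (Xt' ((ξ.1 ++ [a]).dropLast, (ξ.2 ++ [k]).dropLast)))
      rw [h1, hX'ν, hX'S ξ hξ, cutTree_self, dotB_eq (W y), hWb]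
      rintro x ⟨q, hq, rfl⟩
      exact (hCs hq).2.2.2
    · rw [hX'S p hp, hX'S _ (hpar p hp)]
      exact cutTree_closure (hWs y) (hT.1 p hp) (hcl p hp)
  · intro p hp q hq hpq
    rw [eq_empty_iff_forall_notMem]
    rintro z ⟨hz, hz'⟩
    exact hVd p hp q hq hpq z (hVs p hp hz) hz'
  · intro p hp
    refine ⟨V p, hVo p hp, ?_⟩
    ext z
    constructor
    · intro hz
      exact ⟨hVs p hp hz, mem_biUnion hp hz⟩
    · rintro ⟨hz, hz'⟩
      obtain ⟨q, hq, hzq⟩ := mem_iUnion₂.1 hz'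
      by_cases h : p = q
      · rwa [h]
      · exact absurd hzq (hVd p hp q hq h z hz)
  · intro p hp x hx
    rw [hX'S p hp]
    exact hclose p hp x hx
  · rw [hX'ν]
    intro q hq q' hq'
    have b : ∀ q ∈ C, dist q (s, (x₀, y)) ≤ δ / 2 := by
      intro q hq
      have h1 : dist q.1 s ≤ δ / 2 := hCb q hq
      have h2 : dist q.2.1 x₀ ≤ δ / 2 := (hCs hq).2.1
      have h3 : dist q.2.2 y ≤ r / 2 := (hCs hq).2.2.1
      rw [Prod.dist_eq, Prod.dist_eq]
      exact max_le h1 (max_le h2 (by simp only; linarith))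
    linarith [b q hq, b q' hq', dist_triangle_right q q' (s, (x₀, y))]
  · rw [hX'ν]
    rintro x ⟨q, hq, rfl⟩
    have h2 : dist q.2.1 x₀ ≤ δ / 2 := (hCs hq).2.1
    simp only
    linarith

/-! ### Many steps -/

lemma many_steps {A : Set (Hcube × Hcube)}
    (hgraph : ∀ x y y' : Hcube, (x, y) ∈ A → (x, y') ∈ A → y = y')
    {S : Set (List ℕ × List ℕ)} {Xt : List ℕ × List ℕ → Set UnfSp}
    (hST : IsSolidTree A S Xt) (σ : List ℕ) (a : ℕ) (L : List Hcube)
    (hL : ∀ x ∈ L, x ∈ dotSec Xt S σ) :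
    ∀ ε : ℝ, 0 < ε → ∃ (S' : Set (List ℕ × List ℕ)) (Xt' : List ℕ × List ℕ → Set UnfSp),
      S ⊆ S' ∧ (∀ p ∈ S', p ∈ S ∨ p.1 = σ ++ [a]) ∧ IsSolidTree A S' Xt' ∧
      (∀ p ∈ S, Xt' p ⊆ Xt p) ∧
      (∀ p ∈ S, ∀ x ∈ dotB (Xt p), ∃ x' ∈ dotB (Xt' p), dist x x' < ε) ∧
      (∀ p ∈ S', p ∉ S → ∀ q ∈ Xt' p, ∀ q' ∈ Xt' p, dist q q' ≤ ε) ∧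
      (∀ p ∈ S', p ∉ S → ∀ x ∈ dotB (Xt' p), ∃ z ∈ L, dist x z ≤ ε) ∧
      (∀ z ∈ L, ∃ p ∈ S', p.1 = σ ++ [a] ∧ ∃ x ∈ dotB (Xt' p), dist x z ≤ ε) := by
  induction L with
  | nil =>
    intro ε hε
    exact ⟨S, Xt, Subset.refl _, fun p hp => Or.inl hp, hST, fun p _ => Subset.refl _,
      fun p _ x hx => ⟨x, hx, by simpa using hε⟩, fun p hp hp' => absurd hp hp',
      fun p hp hp' => absurd hp hp', by simp⟩
  | cons z L ih =>
    intro ε hε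
    obtain ⟨S₁, X₁, hSS, hnew, hST₁, hsub, hclose, hdiam, hin, hout⟩ :=
      ih (fun x hx => hL x (List.mem_cons_of_mem _ hx)) (ε / 2) (half_pos hε)
    obtain ⟨τ, hτ, hz⟩ := mem_iUnion₂.1 (hL z List.mem_cons_self)
    obtain ⟨z', hz', hzz⟩ := hclose (σ, τ) hτ z hz
    obtain ⟨τ', X₂, hτ', hST₂, hsub₂, hclose₂, hdiam₂, hin₂⟩ :=
      one_step hgraph hST₁ (hSS hτ) a hz' (half_pos hε)
    simp only at hτ' hST₂ hdiam₂ hin₂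
    have hxz : ∀ x ∈ dotB (X₂ (σ ++ [a], τ')), dist x z ≤ ε := fun x hx => by
      linarith [hin₂ x hx, dist_triangle_right x z z']
    refine ⟨insert (σ ++ [a], τ') S₁, X₂, hSS.trans (subset_insert _ _), ?_, hST₂, ?_, ?_, ?_, ?_,
      ?_⟩
    · rintro p (rfl | hp)
      · exact Or.inr rfl
      · exact hnew p hp
    · exact fun p hp => (hsub₂ p (hSS hp)).trans (hsub p hp)
    · intro p hp x hx
      obtain ⟨x', hx', h1⟩ := hclose p hp x hx
      obtain ⟨x'', hx'', h2⟩ := hclose₂ p (hSS hp) x' hx'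
      exact ⟨x'', hx'', by linarith [dist_triangle x x' x'']⟩
    · rintro p (rfl | hp) hpS q hq q' hq'
      · linarith [hdiam₂ q hq q' hq']
      · linarith [hdiam p hp hpS q (hsub₂ p hp hq) q' (hsub₂ p hp hq')]
    · rintro p (rfl | hp) hpS x hx
      · exact ⟨z, List.mem_cons_self, hxz x hx⟩
      · obtain ⟨w, hw, h⟩ := hin p hp hpS x (dotB_mono (hsub₂ p hp) hx)
        exact ⟨w, List.mem_cons_of_mem _ hw, by linarith⟩
    · intro w hw
      rcases List.mem_cons.1 hw with rfl | hw
      · have hn := (hST₂.2.2.1 (σ ++ [a], τ') (mem_insert _ _)).2.1.of_image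
        obtain ⟨q, hq⟩ := hn
        exact ⟨_, mem_insert _ _, rfl, _, ⟨q, hq, rfl⟩, hxz _ ⟨q, hq, rfl⟩⟩
      · obtain ⟨p, hp, hpe, x, hx, hxw⟩ := hout w hw
        obtain ⟨x', hx', h2⟩ := hclose₂ p hp x hx
        exact ⟨p, mem_insert_of_mem _ hp, hpe, x', hx', by
          linarith [dist_triangle_left x' w x]⟩

/-- Lemma 5: a solid tree can be extended one more projection node `η`, with control on
diameters, on the Hausdorff distances of the `Ẋ_σ`'s, and on the Hausdorff distance of
the new `Ẋ_η` to a prescribed set. -/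
theorem solid_tree_extension
    (A : Set (Hcube × Hcube))
    (hgraph : ∀ x y y' : Hcube, (x, y) ∈ A → (x, y') ∈ A → y = y')
    (ε : ℝ) (hε : 0 < ε)
    (S : Set (List ℕ × List ℕ)) (Xt : List ℕ × List ℕ → Set UnfSp)
    (hST : IsSolidTree A S Xt)
    (η : List ℕ) (hη : η ∉ projTree S) (hη' : η.dropLast ∈ projTree S)
    (Y' Y : Set (Hcube × Hcube))
    (hYY' : Prod.fst '' Y' ⊆ closure (Prod.fst '' Y)) :
    ∃ (S' : Set (List ℕ × List ℕ)) (Xt' : List ℕ × List ℕ → Set UnfSp),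
      S ⊆ S' ∧ projTree S' = projTree S ∪ {η} ∧ IsSolidTree A S' Xt' ∧
      (∀ τ : List ℕ, (η, τ) ∈ S' → Metric.diam (Xt' (η, τ)) < ε) ∧
      (∀ p ∈ S, Xt' p ⊆ Xt p) ∧
      (∀ σ ∈ projTree S,
        hausdorffDist (dotSec Xt' S' σ) (dotSec Xt S σ) < ε) ∧
      hausdorffDist (dotSec Xt' S' η) (Prod.fst '' Y') <
        hausdorffDist (dotSec Xt S η.dropLast) (Prod.fst '' Y) + ε := by

  have hbdd : ∀ T : Set Hcube, @Bornology.IsBounded Hcube PseudoMetricSpace.toBornology T := fun T =>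
    isCompact_univ.isBounded.subset (subset_univ T)
  have hηne : η ≠ [] := by
    rintro rfl
    exact hη hη'
  obtain ⟨a, ha⟩ : ∃ a, η.dropLast ++ [a] = η := ⟨_, List.dropLast_append_getLast hηne⟩
  set D := hausdorffDist (dotSec Xt S η.dropLast) (Prod.fst '' Y) with hD
  have hD0 : 0 ≤ D := hausdorffDist_nonneg
  have hsecne : (dotSec Xt S η.dropLast).Nonempty := by
    obtain ⟨τ, hτ⟩ := hη'
    obtain ⟨q, hq⟩ := (hST.2.2.1 _ hτ).2.1.of_image
    exact ⟨q.2.1, mem_biUnion hτ ⟨q, hq, rfl⟩⟩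
  -- the target points
  obtain ⟨L, hLne, hL, hLY, hYL⟩ : ∃ L : List Hcube, L ≠ [] ∧ (∀ x ∈ L, x ∈ dotSec Xt S η.dropLast) ∧
      ((Prod.fst '' Y').Nonempty → ∀ x ∈ L, ∃ y ∈ Prod.fst '' Y', dist x y ≤ D + ε / 4) ∧
      (∀ y ∈ Prod.fst '' Y', ∃ x ∈ L, dist y x ≤ D + ε / 2) := by
    rcases (Prod.fst '' Y').eq_empty_or_nonempty with h | h
    · obtain ⟨x, hx⟩ := hsecne
      exact ⟨[x], by simp, by simpa using hx, by simp [h], by simp [h]⟩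
    · obtain ⟨N, hNs, hNf, hN⟩ := exists_net (Prod.fst '' Y') (δ := ε / 4) (by positivity)
      have hYne : (Prod.fst '' Y).Nonempty := by
        rw [← closure_nonempty_iff]; exact h.mono hYY'
      have hg : ∀ y ∈ Prod.fst '' Y', ∃ x ∈ dotSec Xt S η.dropLast, dist x y ≤ D + ε / 4 := by
        intro y hy
        obtain ⟨v, hv, hyv⟩ := Metric.mem_closure_iff.1 (hYY' hy) (ε / 8) (by positivity)
        obtain ⟨x, hx, hxv⟩ := exists_dist_lt_of_hausdorffDist_lt' (r := D + ε / 8) hv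
          (by rw [hD]; linarith)
          (hausdorffEDist_ne_top_of_nonempty_of_bounded hsecne hYne (hbdd _) (hbdd _))
        refine ⟨x, hx, ?_⟩
        linarith [dist_triangle_right x y v]
      choose! g hg1 hg2 using hg
      refine ⟨hNf.toFinset.toList.map g, ?_, ?_, ?_, ?_⟩
      · obtain ⟨y, hy⟩ := h
        obtain ⟨z, hz, -⟩ := hN y hy
        have : g z ∈ hNf.toFinset.toList.map g :=
          List.mem_map_of_mem (by simpa using hz)
        exact List.ne_nil_of_mem this
      · intro x hx
        obtain ⟨z, hz, rfl⟩ := List.mem_map.1 hx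
        exact hg1 z (hNs (by simpa using hz))
      · intro _ x hx
        obtain ⟨z, hz, rfl⟩ := List.mem_map.1 hx
        have hz' := hNs (by simpa using hz)
        exact ⟨z, hz', hg2 z hz'⟩
      · intro y hy
        obtain ⟨z, hz, hyz⟩ := hN y hy
        refine ⟨g z, List.mem_map_of_mem (by simpa using hz), ?_⟩
        linarith [hg2 z (hNs hz), dist_triangle_right y (g z) z, dist_comm (g z) z]
  obtain ⟨S', X', hSS, hnew, hST', hsub, hclose, hdiam, hin, hout⟩ :=
    many_steps hgraph hST η.dropLast a L hL (ε / 4) (by positivity)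
  rw [ha] at hnew hout
  have hηS : ∀ τ, (η, τ) ∉ S := fun τ h => hη ⟨τ, h⟩
  refine ⟨S', X', hSS, ?_, hST', ?_, hsub, ?_, ?_⟩
  · ext σ
    constructor
    · rintro ⟨τ, hτ⟩
      rcases hnew _ hτ with h | h
      · exact Or.inl ⟨τ, h⟩
      · exact Or.inr h
    · rintro (⟨τ, hτ⟩ | h)
      · exact ⟨τ, hSS hτ⟩
      · obtain ⟨x, hx⟩ := List.exists_mem_of_ne_nil L hLne
        obtain ⟨p, hp, hpe, -⟩ := hout x hx
        refine ⟨p.2, ?_⟩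
        rw [mem_singleton_iff.1 h, ← hpe]
        exact hp
  · intro τ hτ
    have := Metric.diam_le_of_forall_dist_le (by positivity) (hdiam _ hτ (hηS τ))
    linarith
  · intro σ hσ
    have hση : σ ≠ η := fun h => hη (h ▸ hσ)
    have hle : hausdorffDist (dotSec X' S' σ) (dotSec Xt S σ) ≤ ε / 4 := by
      refine hausdorffDist_le_of_mem_dist (by positivity) ?_ ?_
      · intro x hx
        obtain ⟨τ, hτ, hx⟩ := mem_iUnion₂.1 hx
        rcases hnew _ hτ with h | h
        · exact ⟨x, mem_biUnion h (dotB_mono (hsub _ h) hx), by simp; positivity⟩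
        · exact absurd h hση
      · intro x hx
        obtain ⟨τ, hτ, hx⟩ := mem_iUnion₂.1 hx
        obtain ⟨x', hx', h⟩ := hclose _ hτ x hx
        exact ⟨x', mem_biUnion (hSS hτ) hx', h.le⟩
    linarith
  · rcases (Prod.fst '' Y').eq_empty_or_nonempty with h | h
    · rw [h, hausdorffDist_empty]
      linarith
    · have hle : hausdorffDist (dotSec X' S' η) (Prod.fst '' Y') ≤ D + 3 * ε / 4 := by
        refine hausdorffDist_le_of_mem_dist (by positivity) ?_ ?_
        · intro x hx
          obtain ⟨τ, hτ, hx⟩ := mem_iUnion₂.1 hx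
          obtain ⟨z, hz, hxz⟩ := hin _ hτ (hηS τ) x hx
          obtain ⟨y, hy, hzy⟩ := hLY h z hz
          exact ⟨y, hy, by linarith [dist_triangle x z y]⟩
        · intro y hy
          obtain ⟨z, hz, hyz⟩ := hYL y hy
          obtain ⟨p, hp, hpe, x, hx, hxz⟩ := hout z hz
          refine ⟨x, ?_, by linarith [dist_triangle_right y x z]⟩
          refine mem_biUnion (x := p.2) ?_ ?_
          · change (η, p.2) ∈ S'
            rw [← hpe]; exact hp
          · rw [← hpe]; exact hx
      linarith

end
end

section
/- Let S be a tree on ω and let ⟨Ẍ_σ : σ ∈ S⟩ be a Lusin scheme of subsets of a topological space such that for each σ ∈ S the set Ẍ_σ is relatively open in ⋃{Ẍ_ρ : ρ ∈ S, lh ρ = lh σ}. Let Σ ⊆ S be an antichain (no element of Σ is an initial segment of another). Then for each σ ∈ Σ, the set Ẍ_σ is relatively open in ⋃{Ẍ_ρ : ρ ∈ Σ}. -/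
open Set Topology

noncomputable section

/-- Lemma 6: if `⟨Ẍ_σ : σ ∈ S⟩` is a Lusin scheme such that each `Ẍ_σ` is relatively
open in the union of the sets of its level, and `Σ ⊆ S` is an antichain, then each
`Ẍ_σ` for `σ ∈ Σ` is relatively open in `⋃ {Ẍ_ρ : ρ ∈ Σ}`. -/
theorem lusin_scheme_antichain_relatively_open
    {α : Type*} [TopologicalSpace α]
    (S : Set (List ℕ)) (hS : ∀ σ ∈ S, ∀ n : ℕ, σ.take n ∈ S)
    (X : List ℕ → Set α)
    (hmono : ∀ σ ∈ S, σ ≠ [] → X σ ⊆ X σ.dropLast)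
    (hdisj : ∀ σ ∈ S, ∀ ρ ∈ S, σ.length = ρ.length → σ ≠ ρ → X σ ∩ X ρ = ∅)
    (hopen : ∀ σ ∈ S, ∃ U : Set α, IsOpen U ∧
        X σ = U ∩ ⋃ ρ ∈ {ρ ∈ S | ρ.length = σ.length}, X ρ)
    (Sig : Set (List ℕ)) (hSigS : Sig ⊆ S)
    (hanti : ∀ σ ∈ Sig, ∀ τ ∈ Sig, σ ≠ τ → ¬ σ <+: τ) :
    ∀ σ ∈ Sig, ∃ U : Set α, IsOpen U ∧ X σ = U ∩ ⋃ ρ ∈ Sig, X ρ := by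
  have key : ∀ k : ℕ, ∀ σ ∈ S, X σ ⊆ X (σ.take (σ.length - k)) := by
    intro k
    induction k with
    | zero => intro σ _; simp
    | succ k ih =>
      intro σ hσ
      refine (ih σ hσ).trans ?_
      by_cases h : σ.take (σ.length - k) = []
      · have h2 : σ.take (σ.length - (k+1)) = [] := by
          rw [List.take_eq_nil_iff] at h ⊢
          rcases h with h | h
          · left; omega
          · right; exact h
        rw [h, h2]
      · refine (hmono _ (hS σ hσ _) h).trans ?_
        rw [List.dropLast_eq_take, List.take_take, List.length_take]
        have : min (min (σ.length - k) σ.length - 1) (σ.length - k) = σ.length - (k+1) := by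
          omega
        rw [this]
  have key2 : ∀ σ ∈ S, ∀ n ≤ σ.length, X σ ⊆ X (σ.take n) := by
    intro σ hσ n hn
    have := key (σ.length - n) σ hσ
    rwa [Nat.sub_sub_self hn] at this
  intro σ hσ
  have hσS := hSigS hσ
  choose U hU hXU using fun n : ℕ => hopen (σ.take n) (hS σ hσS n)
  refine ⟨⋂ n ∈ Finset.range (σ.length + 1), U n,
    isOpen_biInter_finset fun n _ => hU n, ?_⟩
  ext x
  constructor
  · intro hx
    refine ⟨?_, mem_biUnion hσ hx⟩
    simp only [mem_iInter, Finset.mem_range]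
    intro n hn
    have h := key2 σ hσS n (by omega) hx
    rw [hXU n] at h
    exact h.1
  · rintro ⟨hxU, hx⟩
    simp only [mem_iInter, Finset.mem_range] at hxU
    simp only [mem_iUnion] at hx
    obtain ⟨ρ, hρ, hx⟩ := hx
    have hρS := hSigS hρ
    rcases le_total σ.length ρ.length with hl | hl
    · have h1 := key2 ρ hρS _ hl hx
      have h2 : x ∈ X (σ.take σ.length) := by
        rw [hXU]
        refine ⟨hxU _ (by omega), mem_biUnion ⟨hS ρ hρS σ.length, ?_⟩ h1⟩
        simp [hl]
      simpa using h2
    · have h2 : x ∈ X (σ.take ρ.length) := by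
        rw [hXU]
        refine ⟨hxU _ (by omega), mem_biUnion ⟨hρS, ?_⟩ hx⟩
        simp [hl]
      have h3 : ρ = σ.take ρ.length := by
        by_contra hne
        have := hdisj ρ hρS _ (hS σ hσS ρ.length) (by simp [hl]) hne
        exact (this ▸ (⟨hx, h2⟩ : x ∈ X ρ ∩ X (σ.take ρ.length)) : x ∈ (∅ : Set α))
      have h4 : ρ = σ := by
        by_contra hne
        exact hanti ρ hρ σ hσ hne (h3 ▸ List.take_prefix _ _)
      exact h4 ▸ hx

end
end
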